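/- For every n ≥ 1 there do not exist vectors β_1, …, β_6 ∈ ℝ^n, each of the form ±e_i ± e_j for some 1 ≤ i < j ≤ n, such that the Gram matrix (⟪β_r, β_s⟫)_{1 ≤ r, s ≤ 6} equals the Cartan matrix of E_6. In other words, the root system E_6 is not contained in the root system D_n. -/

import Mathlib

open RealInnerProductSpace

/-- A root of the root system `D_n` inside `ℝ^n`: a vector of the form `±e_i ± e_j`
with `i < j`. -/
def IsRootDn (n : ℕ) (x : EuclideanSpace ℝ (Fin n)) : Prop :=
  ∃ i j : Fin n, i < j ∧
    (x = EuclideanSpace.single i (1 : ℝ) + EuclideanSpace.single j (1 : ℝ) ∨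
     x = EuclideanSpace.single i (1 : ℝ) - EuclideanSpace.single j (1 : ℝ) ∨
     x = -EuclideanSpace.single i (1 : ℝ) + EuclideanSpace.single j (1 : ℝ) ∨
     x = -EuclideanSpace.single i (1 : ℝ) - EuclideanSpace.single j (1 : ℝ))

/-- The Cartan matrix of `E₆` (Bourbaki numbering). -/
def cartanE6 : Matrix (Fin 6) (Fin 6) ℝ :=
  !![ 2,  0, -1,  0,  0,  0;
      0,  2,  0, -1,  0,  0;
     -1,  0,  2, -1,  0,  0;
      0, -1, -1,  2, -1,  0;
      0,  0,  0, -1,  2, -1;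
      0,  0,  0,  0, -1,  2]

/-- `x = ±e_i ± e_j` with `i ≠ j`; the two indices play symmetric roles. -/
def IsRootOn {n : ℕ} (x : EuclideanSpace ℝ (Fin n)) (i j : Fin n) : Prop :=
  i ≠ j ∧ ∃ s t : ℝ, (s = 1 ∨ s = -1) ∧ (t = 1 ∨ t = -1) ∧
    x = EuclideanSpace.single i s + EuclideanSpace.single j t

lemma IsRootDn.exists_isRootOn {n : ℕ} {x : EuclideanSpace ℝ (Fin n)} (hx : IsRootDn n x) :
    ∃ i j, IsRootOn x i j := by
  obtain ⟨i, j, hij, h⟩ := hx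
  refine ⟨i, j, hij.ne, ?_⟩
  rcases h with rfl | rfl | rfl | rfl
  · exact ⟨1, 1, by simp, by simp, rfl⟩
  · exact ⟨1, -1, by simp, by simp, by ext; simp [sub_eq_add_neg, neg_ite]⟩
  · exact ⟨-1, 1, by simp, by simp, by ext; simp [neg_ite]⟩
  · exact ⟨-1, -1, by simp, by simp, by ext; simp [sub_eq_add_neg, neg_ite]⟩

lemma IsRootOn.symm {n : ℕ} {x : EuclideanSpace ℝ (Fin n)} {i j : Fin n}
    (h : IsRootOn x i j) : IsRootOn x j i := by
  obtain ⟨hij, s, t, hs, ht, rfl⟩ := h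
  exact ⟨hij.symm, t, s, ht, hs, add_comm _ _⟩

lemma inner_single_add_single {n : ℕ} (i j k l : Fin n) (s t u v : ℝ) :
    ⟪(EuclideanSpace.single i s + EuclideanSpace.single j t : EuclideanSpace ℝ (Fin n)),
      EuclideanSpace.single k u + EuclideanSpace.single l v⟫ =
    (if i = k then s * u else 0) + (if i = l then s * v else 0) +
      ((if j = k then t * u else 0) + (if j = l then t * v else 0)) := by
  simp only [inner_add_left, inner_add_right, EuclideanSpace.inner_single_left]
  simp
  ring

/-- Roots with nonzero inner product have a common index. -/
lemma IsRootOn.exists_common_index {n : ℕ} {c x : EuclideanSpace ℝ (Fin n)} {i j : Fin n}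
    (hc : IsRootOn c i j) (hx : IsRootDn n x) (h : ⟪x, c⟫ ≠ 0) :
    ∃ k, IsRootOn x i k ∨ IsRootOn x j k := by
  obtain ⟨a, b, hab⟩ := hx.exists_isRootOn
  by_cases hai : a = i
  · exact ⟨b, .inl (hai ▸ hab)⟩
  by_cases haj : a = j
  · exact ⟨b, .inr (haj ▸ hab)⟩
  by_cases hbi : b = i
  · exact ⟨a, .inl (hbi ▸ hab.symm)⟩
  by_cases hbj : b = j
  · exact ⟨a, .inr (hbj ▸ hab.symm)⟩
  obtain ⟨-, s, t, -, -, rfl⟩ := hc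
  obtain ⟨-, u, v, -, -, rfl⟩ := hab
  simp [inner_single_add_single, hai, haj, hbi, hbj] at h

/-- Orthogonal roots with a common index have the same pair of indices. -/
lemma IsRootOn.eq_of_inner_eq_zero {n : ℕ} {x y : EuclideanSpace ℝ (Fin n)} {i k l : Fin n}
    (hx : IsRootOn x i k) (hy : IsRootOn y i l) (h : ⟪x, y⟫ = 0) : k = l := by
  obtain ⟨hik, s, t, hs, ht, rfl⟩ := hx
  obtain ⟨hil, u, v, hu, hv, rfl⟩ := hy
  by_contra hkl
  rcases hs with rfl | rfl <;> rcases hu with rfl | rfl <;>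
    simp [inner_single_add_single, hkl, hil, hik.symm] at h

lemma IsRootOn.inner_ne_neg_one_of_same_indices {n : ℕ} {x y : EuclideanSpace ℝ (Fin n)}
    {i k : Fin n} (hx : IsRootOn x i k) (hy : IsRootOn y i k) : ⟪x, y⟫ ≠ -1 := by
  obtain ⟨hik, s, t, hs, ht, rfl⟩ := hx
  obtain ⟨-, u, v, hu, hv, rfl⟩ := hy
  rw [inner_single_add_single]
  rcases hs with rfl | rfl <;> rcases ht with rfl | rfl <;> rcases hu with rfl | rfl <;>
    rcases hv with rfl | rfl <;> norm_num [hik, hik.symm]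

/-- If two orthogonal roots have a common index, then no root is orthogonal to one of them and
has inner product `-1` with the other. -/
lemma IsRootOn.inner_ne_neg_one {n : ℕ} {x y z : EuclideanSpace ℝ (Fin n)} {i k l : Fin n}
    (hx : IsRootOn x i k) (hy : IsRootOn y i l) (hxy : ⟪x, y⟫ = 0)
    (hz : IsRootDn n z) (hzy : ⟪z, y⟫ = 0) : ⟪z, x⟫ ≠ -1 := by
  intro hzx
  obtain rfl := hx.eq_of_inner_eq_zero hy hxy
  obtain ⟨m, hm | hm⟩ := hx.exists_common_index hz (by rw [hzx]; norm_num)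
  · obtain rfl := hm.eq_of_inner_eq_zero hy hzy
    exact hm.inner_ne_neg_one_of_same_indices hx hzx
  · obtain rfl := hm.eq_of_inner_eq_zero hy.symm hzy
    exact hm.inner_ne_neg_one_of_same_indices hx.symm hzx

/-- The root system `E₆` is not contained in the root system `D_n`. -/
theorem E6_not_subset_Dn (n : ℕ) (hn : 1 ≤ n) :
    ¬ ∃ β : Fin 6 → EuclideanSpace ℝ (Fin n),
      (∀ r, IsRootDn n (β r)) ∧ ∀ r s, ⟪β r, β s⟫ = cartanE6 r s := by
  rintro ⟨β, hβ, hG⟩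
  obtain ⟨i, j, hc⟩ := (hβ 3).exists_isRootOn
  obtain ⟨k₁, h₁⟩ := hc.exists_common_index (hβ 1) (by simp [hG, cartanE6])
  obtain ⟨k₂, h₂⟩ := hc.exists_common_index (hβ 2) (by simp [hG, cartanE6])
  obtain ⟨k₄, h₄⟩ := hc.exists_common_index (hβ 4) (by simp [hG, cartanE6])
  -- Two of the three neighbours of the branch node share an index, which the following exclude.
  have not_two_one {a k l} (hx : IsRootOn (β 2) a k) (hy : IsRootOn (β 1) a l) : False :=
    hx.inner_ne_neg_one hy (by simp [hG, cartanE6]) (hβ 0) (by simp [hG, cartanE6])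
      (by simp [hG, cartanE6])
  have not_four_one {a k l} (hx : IsRootOn (β 4) a k) (hy : IsRootOn (β 1) a l) : False :=
    hx.inner_ne_neg_one hy (by simp [hG, cartanE6]) (hβ 5) (by simp [hG, cartanE6])
      (by simp [hG, cartanE6])
  have not_two_four {a k l} (hx : IsRootOn (β 2) a k) (hy : IsRootOn (β 4) a l) : False :=
    hx.inner_ne_neg_one hy (by simp [hG, cartanE6]) (hβ 0) (by simp [hG, cartanE6])
      (by simp [hG, cartanE6])
  rcases h₁ with h₁ | h₁ <;> rcases h₂ with h₂ | h₂ <;> rcases h₄ with h₄ | h₄ <;>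
    first
    | exact not_two_one h₂ h₁
    | exact not_four_one h₄ h₁
    | exact not_two_four h₂ h₄
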